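/- Corollary (preservation of the optimum): assume z = ∑_{1 ≤ p ≤ q ≤ n} |Q_{p,q}|, and assume there exists a global minimizer x* of H over {0,1}^n with x*_i = 0 or x*_j = 0 (which holds in particular when (i,j) are conflicting qubits). Then the minimum of the modified energy over all binary vectors of length n+1 equals the minimum of the original energy: min over x ∈ {0,1}^n and b ∈ {0,1} of H_mod(x, b) = min over x ∈ {0,1}^n of H(x). -/

import Mathlib

/-- The QUBO energy `H(x) = ∑_{p ≤ q} x_p x_q Q_{p,q}`. -/
def energy {m : ℕ} (A : Matrix (Fin m) (Fin m) ℝ) (x : Fin m → ℝ) : ℝ :=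
  ∑ p : Fin m, ∑ q ∈ Finset.Ici p, x p * x q * A p q

/-- `x` is a binary ({0,1}-valued) vector. -/
def IsBinary {m : ℕ} (x : Fin m → ℝ) : Prop := ∀ p, x p = 0 ∨ x p = 1

/-- The row/column of the ancilla qubit in the enhanced matrix. -/
def ancRow {n : ℕ} (Q : Matrix (Fin n) (Fin n) ℝ) (i j : Fin n) (U : Finset (Fin n)) (z : ℝ)
    (k : Fin n) : ℝ :=
  if k = i ∨ k = j then -2 * z else if k ∈ U then Q i k else 0

/-- The enhanced matrix restricted to the original `n × n` block. -/
def coreMod {n : ℕ} (Q : Matrix (Fin n) (Fin n) ℝ) (i j : Fin n) (U : Finset (Fin n)) (z : ℝ) :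
    Matrix (Fin n) (Fin n) ℝ := fun p q =>
  if p = i ∧ q = i then Q i i + z
  else if p = j ∧ q = j then Q j j + z
  else if (p = i ∧ q = j) ∨ (p = j ∧ q = i) then 2 * z
  else if ((p = i ∨ p = j) ∧ q ∈ U) ∨ (p ∈ U ∧ (q = i ∨ q = j)) then 0
  else Q p q

/-- The enhanced `(n+1) × (n+1)` matrix `Q_mod`, the ancilla being the last index. -/
def QMod {n : ℕ} (Q : Matrix (Fin n) (Fin n) ℝ) (i j : Fin n) (U : Finset (Fin n)) (z : ℝ) :
    Matrix (Fin (n + 1)) (Fin (n + 1)) ℝ := fun p q =>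
  Fin.lastCases
    (Fin.lastCases z (fun k => ancRow Q i j U z k) q)
    (fun p' => Fin.lastCases (ancRow Q i j U z p') (fun q' => coreMod Q i j U z p' q') q)
    p

/-- The modified energy `H_mod(x, b)`: the energy of `x` extended by the ancilla value `b`. -/
noncomputable def energyMod {n : ℕ} (Q : Matrix (Fin n) (Fin n) ℝ) (i j : Fin n)
    (U : Finset (Fin n)) (z : ℝ) (x : Fin n → ℝ) (b : ℝ) : ℝ :=
  energy (QMod Q i j U z) (Fin.snoc x b)

/-- `z = ∑_{p ≤ q} |Q_{p,q}|`, the value of `z` used in the correctness proposition. -/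
def totalWeight {n : ℕ} (Q : Matrix (Fin n) (Fin n) ℝ) : ℝ :=
  ∑ p : Fin n, ∑ q ∈ Finset.Ici p, |Q p q|

theorem sum_Ici_eq_sum_ite {m : ℕ} (f : Fin m → Fin m → ℝ) :
    ∑ p, ∑ q ∈ Finset.Ici p, f p q = ∑ p, ∑ q, if p ≤ q then f p q else 0 := by
  refine Finset.sum_congr rfl fun p _ => ?_
  rw [← Finset.sum_filter]
  refine Finset.sum_congr ?_ fun _ _ => rfl
  ext q
  simp

theorem energy_eq_sum_ite {m : ℕ} (A : Matrix (Fin m) (Fin m) ℝ) (x : Fin m → ℝ) :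
    energy A x = ∑ p, ∑ q, if p ≤ q then x p * x q * A p q else 0 :=
  sum_Ici_eq_sum_ite fun p q => x p * x q * A p q

/-- Twice the sum of a symmetric function over ordered pairs `p ≤ q` is the full double sum plus
the diagonal. -/
theorem two_mul_sum_Ici_of_symm {m : ℕ} (f : Fin m → Fin m → ℝ) (hf : ∀ p q, f p q = f q p) :
    2 * ∑ p, ∑ q ∈ Finset.Ici p, f p q = ∑ p, ∑ q, f p q + ∑ p, f p p := by
  have h2 : (∑ p, ∑ q, if p ≤ q then f p q else 0) = ∑ p, ∑ q, if q ≤ p then f p q else 0 := by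
    rw [Finset.sum_comm]
    refine Finset.sum_congr rfl fun p _ => Finset.sum_congr rfl fun q _ => ?_
    rw [hf p q]
  have h3 : ∑ p, f p p = ∑ p, ∑ q, if p = q then f p q else 0 := by simp
  rw [two_mul, sum_Ici_eq_sum_ite]
  nth_rewrite 2 [h2]
  rw [h3, ← Finset.sum_add_distrib, ← Finset.sum_add_distrib]
  refine Finset.sum_congr rfl fun p _ => ?_
  rw [← Finset.sum_add_distrib, ← Finset.sum_add_distrib]
  refine Finset.sum_congr rfl fun q _ => ?_
  rcases lt_trichotomy p q with h | h | h
  · simp [h.le, h.not_ge, h.ne]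
  · simp [h]
  · simp [h.le, h.not_ge, h.ne']

theorem two_mul_energy_of_symm {m : ℕ} (A : Matrix (Fin m) (Fin m) ℝ)
    (hA : ∀ p q, A p q = A q p) (x : Fin m → ℝ) :
    2 * energy A x = ∑ p, ∑ q, x p * x q * A p q + ∑ p, x p * x p * A p p :=
  two_mul_sum_Ici_of_symm (fun p q => x p * x q * A p q) fun p q => by
    rw [hA p q, mul_comm (x p)]

theorem sum_row_abs_le_totalWeight {n : ℕ} (Q : Matrix (Fin n) (Fin n) ℝ)
    (hQ : ∀ p q, Q p q = Q q p) (i : Fin n) : ∑ q, |Q i q| ≤ totalWeight Q := by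
  have h : 2 * totalWeight Q = ∑ p, ∑ q, |Q p q| + ∑ p, |Q p p| :=
    two_mul_sum_Ici_of_symm (fun p q => |Q p q|) fun p q => by rw [hQ p q]
  have h1 : ∑ p, (|Q i p| + if p = i then ∑ q, |Q i q| else 0) ≤
      ∑ p, (∑ q, |Q p q| + |Q p p|) := by
    refine Finset.sum_le_sum fun p _ => ?_
    split_ifs with hp
    · subst hp
      exact (add_comm _ _).le
    · have := Finset.single_le_sum (f := fun q => |Q p q|) (fun q _ => abs_nonneg _)
        (Finset.mem_univ i)
      have := abs_nonneg (Q p p)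
      rw [hQ i p, add_zero]
      linarith
  rw [Finset.sum_add_distrib, Finset.sum_add_distrib, ← h] at h1
  simp only [Finset.sum_ite_eq', Finset.mem_univ, if_true] at h1
  linarith

theorem abs_add_abs_sum_le_totalWeight {n : ℕ} (Q : Matrix (Fin n) (Fin n) ℝ)
    (hQ : ∀ p q, Q p q = Q q p) (i j : Fin n) (U : Finset (Fin n)) (hjU : j ∉ U)
    (x : Fin n → ℝ) (hx : IsBinary x) :
    |Q i j| + |∑ k ∈ U, x k * Q i k| ≤ totalWeight Q := by
  have h1 : |∑ k ∈ U, x k * Q i k| ≤ ∑ k ∈ U, |Q i k| := by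
    refine (Finset.abs_sum_le_sum_abs _ _).trans (Finset.sum_le_sum fun k _ => ?_)
    rcases hx k with h | h <;> simp [h]
  have h2 : ∑ k ∈ insert j U, |Q i k| ≤ ∑ k, |Q i k| :=
    Finset.sum_le_sum_of_subset_of_nonneg (Finset.subset_univ _) fun _ _ _ => abs_nonneg _
  rw [Finset.sum_insert hjU] at h2
  linarith [sum_row_abs_le_totalWeight Q hQ i]

theorem coreMod_eq {n : ℕ} (Q : Matrix (Fin n) (Fin n) ℝ) (hQ : ∀ p q, Q p q = Q q p)
    (i j : Fin n) (hij : i ≠ j) (U : Finset (Fin n)) (hiU : i ∉ U) (hjU : j ∉ U)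
    (hU : ∀ k ∈ U, Q i k = Q j k) (z : ℝ) (p q : Fin n) :
    coreMod Q i j U z p q = Q p q
      + (if p = i then if q = i then z else 0 else 0)
      + (if p = j then if q = j then z else 0 else 0)
      + (if p = i then if q = j then 2 * z - Q i j else 0 else 0)
      + (if p = j then if q = i then 2 * z - Q i j else 0 else 0)
      - (if p = i then if q ∈ U then Q i q else 0 else 0)
      - (if p = j then if q ∈ U then Q i q else 0 else 0)
      - (if q = i then if p ∈ U then Q i p else 0 else 0)
      - (if q = j then if p ∈ U then Q i p else 0 else 0) := by
  unfold coreMod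
  grind

theorem energy_coreMod {n : ℕ} (Q : Matrix (Fin n) (Fin n) ℝ) (hQ : ∀ p q, Q p q = Q q p)
    (i j : Fin n) (hij : i ≠ j) (U : Finset (Fin n)) (hiU : i ∉ U) (hjU : j ∉ U)
    (hU : ∀ k ∈ U, Q i k = Q j k) (z : ℝ) (x : Fin n → ℝ) :
    energy (coreMod Q i j U z) x = energy Q x + z * (x i * x i) + z * (x j * x j)
      + (2 * z - Q i j) * (x i * x j) - (x i + x j) * ∑ k ∈ U, x k * Q i k := by
  have hc := coreMod_eq Q hQ i j hij U hiU hjU hU z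
  have hs : ∀ p q, coreMod Q i j U z p q = coreMod Q i j U z q p := by
    intro p q
    rw [hc, hc, hQ p q]
    grind
  have h1 := two_mul_energy_of_symm _ hs x
  have h2 := two_mul_energy_of_symm _ hQ x
  have hd : ∑ p, x p * x p * coreMod Q i j U z p p
      = ∑ p, x p * x p * Q p p + z * (x i * x i) + z * (x j * x j) := by
    have : ∀ p, x p * x p * coreMod Q i j U z p p = x p * x p * Q p p
        + (if p = i then z * (x i * x i) else 0) + (if p = j then z * (x j * x j) else 0) := by
      intro p
      rw [hc]
      grind
    simp [this, Finset.sum_add_distrib]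
  have hf : ∑ p, ∑ q, x p * x q * coreMod Q i j U z p q
      = ∑ p, ∑ q, x p * x q * Q p q + z * (x i * x i) + z * (x j * x j)
        + 2 * ((2 * z - Q i j) * (x i * x j)) - 2 * ((x i + x j) * ∑ k ∈ U, x k * Q i k) := by
    have hrow : ∀ a, ∑ p, ∑ q, x p * x q * (if p = a then if q ∈ U then Q i q else 0 else 0)
        = x a * ∑ k ∈ U, x k * Q i k := by
      intro a
      rw [Finset.sum_eq_single a (by intro p _ hp; simp [hp]) (by simp)]
      simp [Finset.mul_sum, mul_assoc]
    have hcol : ∀ a, ∑ p, ∑ q, x p * x q * (if q = a then if p ∈ U then Q i p else 0 else 0)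
        = x a * ∑ k ∈ U, x k * Q i k := by
      intro a
      rw [← hrow a, Finset.sum_comm]
      simp only [mul_comm (x _) (x _)]
    have hone : ∀ (a c : Fin n) (w : ℝ),
        ∑ p, ∑ q, x p * x q * (if p = a then if q = c then w else 0 else 0)
          = x a * x c * w := by
      intro a c w
      rw [Finset.sum_eq_single a (by intro p _ hp; simp [hp]) (by simp)]
      simp
    simp only [hc, mul_add, mul_sub, Finset.sum_add_distrib, Finset.sum_sub_distrib,
      hrow, hcol, hone]
    simp only [← mul_sub]
    ring
  linarith

theorem energyMod_eq {n : ℕ} (Q : Matrix (Fin n) (Fin n) ℝ) (i j : Fin n)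
    (U : Finset (Fin n)) (z : ℝ) (x : Fin n → ℝ) (b : ℝ) :
    energyMod Q i j U z x b = energy (coreMod Q i j U z) x
      + b * ∑ k, x k * ancRow Q i j U z k + z * (b * b) := by
  unfold energyMod
  rw [energy_eq_sum_ite, energy_eq_sum_ite, Fin.sum_univ_castSucc]
  simp only [Fin.sum_univ_castSucc, Fin.snoc_castSucc, Fin.snoc_last, QMod, Fin.lastCases_castSucc,
    Fin.lastCases_last, Fin.castSucc_le_castSucc_iff, Fin.le_last, if_true,
    Finset.sum_add_distrib, Finset.mul_sum]
  have : ∀ k : Fin n, ¬ Fin.last n ≤ k.castSucc := fun k => not_le.2 (Fin.castSucc_lt_last k)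
  simp only [this, if_false, Finset.sum_const_zero, zero_add]
  rw [Finset.sum_congr rfl fun k _ => show x k * b * ancRow Q i j U z k
    = b * (x k * ancRow Q i j U z k) by ring]
  ring

theorem sum_mul_ancRow {n : ℕ} (Q : Matrix (Fin n) (Fin n) ℝ) (i j : Fin n) (hij : i ≠ j)
    (U : Finset (Fin n)) (hiU : i ∉ U) (hjU : j ∉ U) (z : ℝ) (x : Fin n → ℝ) :
    ∑ k, x k * ancRow Q i j U z k
      = -2 * z * (x i + x j) + ∑ k ∈ U, x k * Q i k := by
  have : ∀ k, x k * ancRow Q i j U z k = (if k = i then -2 * z * x i else 0)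
      + (if k = j then -2 * z * x j else 0) + (if k ∈ U then x k * Q i k else 0) := by
    intro k
    unfold ancRow
    grind
  simp only [this, Finset.sum_add_distrib, Finset.sum_ite_eq', Finset.mem_univ, if_true,
    Finset.sum_ite_mem, Finset.univ_inter]
  ring

/-- The modified energy is the original one plus the penalty and routing terms of the ancilla. -/
theorem energyMod_eq_energy_add {n : ℕ} (Q : Matrix (Fin n) (Fin n) ℝ)
    (hQ : ∀ p q, Q p q = Q q p)
    (i j : Fin n) (hij : i ≠ j) (U : Finset (Fin n)) (hiU : i ∉ U) (hjU : j ∉ U)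
    (hU : ∀ k ∈ U, Q i k = Q j k) (z : ℝ) (x : Fin n → ℝ) (b : ℝ) :
    energyMod Q i j U z x b = energy Q x + z * (x i * x i) + z * (x j * x j)
      + (2 * z - Q i j) * (x i * x j) - 2 * z * b * (x i + x j) + z * (b * b)
      + (b - (x i + x j)) * ∑ k ∈ U, x k * Q i k := by
  rw [energyMod_eq, energy_coreMod Q hQ i j hij U hiU hjU hU,
    sum_mul_ancRow Q i j hij U hiU hjU]
  ring

theorem optimum_preserved {n : ℕ} (Q : Matrix (Fin n) (Fin n) ℝ) (hQ : Q.IsSymm)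
    (i j : Fin n) (hij : i ≠ j) (U : Finset (Fin n)) (hiU : i ∉ U) (hjU : j ∉ U)
    (hU : ∀ k ∈ U, Q i k = Q j k) (z : ℝ) (hz : z = totalWeight Q)
    (hopt : ∃ xstar : Fin n → ℝ, IsBinary xstar ∧ (xstar i = 0 ∨ xstar j = 0) ∧
      ∀ y : Fin n → ℝ, IsBinary y → energy Q xstar ≤ energy Q y) :
    sInf {e : ℝ | ∃ (x : Fin n → ℝ) (b : ℝ), IsBinary x ∧ (b = 0 ∨ b = 1) ∧
        e = energyMod Q i j U z x b}
      = sInf {e : ℝ | ∃ x : Fin n → ℝ, IsBinary x ∧ e = energy Q x} := by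
  have hS : ∀ p q, Q p q = Q q p := fun p q => hQ.apply q p
  have hE := energyMod_eq_energy_add Q hS i j hij U hiU hjU hU z
  obtain ⟨xs, hxs, h0, hmin⟩ := hopt
  have hmod : IsLeast {e : ℝ | ∃ (x : Fin n → ℝ) (b : ℝ), IsBinary x ∧ (b = 0 ∨ b = 1) ∧
      e = energyMod Q i j U z x b} (energy Q xs) := by
    constructor
    · refine ⟨xs, xs i + xs j, hxs, ?_, ?_⟩
      · rcases h0 with h | h
        · simpa [h] using hxs j
        · simpa [h] using hxs i
      · rw [hE]
        rcases h0 with h | h <;> rw [h] <;> ring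
    · rintro e ⟨x, b, hx, hb, rfl⟩
      refine (hmin x hx).trans ?_
      have hw := abs_add_abs_sum_le_totalWeight Q hS i j U hjU x hx
      rw [← hz] at hw
      rw [hE]
      generalize ∑ k ∈ U, x k * Q i k = S at *
      have := le_abs_self S
      have := neg_abs_le S
      have := le_abs_self (Q i j)
      have := abs_nonneg (Q i j)
      rcases hx i with hi | hi <;> rcases hx j with hj | hj <;> rcases hb with hb | hb <;>
        rw [hi, hj, hb] <;> linarith
  have horig : IsLeast {e : ℝ | ∃ x : Fin n → ℝ, IsBinary x ∧ e = energy Q x}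
      (energy Q xs) := by
    refine ⟨⟨xs, hxs, rfl⟩, ?_⟩
    rintro e ⟨x, hx, rfl⟩
    exact hmin x hx
  rw [hmod.csInf_eq, horig.csInf_eq]
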